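/- Let q = p^k with p prime and k ≥ 4. Then every prime divisor of the order of PSL(2,q) is at most 1000 if and only if q belongs to the set {2^4, 2^5, 2^6, 2^7, 2^8, 2^9, 2^10, 2^11, 2^12, 2^14, 2^15, 2^18, 2^24, 3^4, 3^5, 3^6, 3^8, 3^9, 5^4, 5^5, 5^6, 7^6, 19^6, 29^6, 43^4}. -/

import Mathlib

open scoped MatrixGroups

/-! ### Smoothness tests by modular squaring -/

/-- The result of squaring `x` modulo `N` repeatedly, `e` times. -/
def iterSqMod (N : ℕ) : ℕ → ℕ → ℕ
  | 0, x => x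
  | e + 1, x => iterSqMod N e (x ^ 2 % N)

/-- Whether `N` divides `(1000!) ^ (2 ^ e)`. -/
def smoothTest (N e : ℕ) : Bool :=
  iterSqMod N e (Nat.factorial 1000) % N == 0

/-- Whether all prime factors of `p ^ n - 1` are at most `1000`. -/
def powSubOneTest (p n : ℕ) : Bool :=
  smoothTest (p ^ n - 1) (((p.log2 + 1) * n).log2 + 1)

/-- Whether `n` has a proper divisor among the primes up to `31`. -/
def smallFactor (n : ℕ) : Bool :=
  [2, 3, 5, 7, 11, 13, 17, 19, 23, 29, 31].any fun d => n % d == 0 && d.blt n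

/-- The prime powers `q` in the classification. -/
def listedOrders : List ℕ :=
  [2 ^ 4, 2 ^ 5, 2 ^ 6, 2 ^ 7, 2 ^ 8, 2 ^ 9, 2 ^ 10, 2 ^ 11, 2 ^ 12, 2 ^ 14,
    2 ^ 15, 2 ^ 18, 2 ^ 24, 3 ^ 4, 3 ^ 5, 3 ^ 6, 3 ^ 8, 3 ^ 9, 5 ^ 4, 5 ^ 5, 5 ^ 6,
    7 ^ 6, 19 ^ 6, 29 ^ 6, 43 ^ 4]

/-- Two numbers whose product is divisible by every `k` such that `p ^ (2 * k) - 1` has all its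
prime factors at most `1000`. -/
def exponentBound (p : ℕ) : ℕ × ℕ :=
  if p = 2 then (168, 165) else if p = 3 then (8, 45) else if p = 5 then (4, 15)
    else if p = 43 then (4, 3) else (2, 3)

/-- For every prime `l < 500`, some prime power `l ^ (e + 1)` with `l ^ e ∣ M` cannot divide an
exponent `k` such that `p ^ (2 * k) - 1` has all its prime factors at most `1000`. -/
def exponentBoundTest (p M : ℕ) : Bool :=
  (List.range 500).all fun l => l.ble 1 || smallFactor l ||
    (List.range 4).any fun e => M % l ^ e == 0 &&
      (!powSubOneTest p (l ^ (e + 1)) || !powSubOneTest p (2 * l ^ (e + 1)))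

/-- Every divisor `k ≥ 4` of `M * N` gives a listed prime power `p ^ k`, or else `p ^ (2 * k) - 1`
has a prime factor greater than `1000`. -/
def divisorTest (p M N : ℕ) : Bool :=
  (List.range (M + 1)).all fun a => !(M % a == 0) ||
    (List.range (N + 1)).all fun b => !(N % b == 0) || (a * b).ble 3 ||
      listedOrders.contains (p ^ (a * b)) || !powSubOneTest p (2 * (a * b))

theorem smoothTest_listedOrders :
    listedOrders.all (fun q => smoothTest (q * (q ^ 2 - 1)) 8) = true := by
  decide +kernel

theorem exponentBoundTest_exponentBound :
    (List.range 1001).all (fun p => p.ble 1 || smallFactor p ||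
      exponentBoundTest p ((exponentBound p).1 * (exponentBound p).2)) = true := by
  decide +kernel

theorem divisorTest_exponentBound :
    (List.range 1001).all (fun p => p.ble 1 || smallFactor p ||
      divisorTest p (exponentBound p).1 (exponentBound p).2) = true := by
  decide +kernel

theorem iterSqMod_modEq (N e x : ℕ) : iterSqMod N e x ≡ x ^ 2 ^ e [MOD N] := by
  induction e generalizing x with
  | zero => simp [iterSqMod, Nat.ModEq.refl]
  | succ e ih =>
    rw [pow_succ' 2 e, pow_mul]
    refine (ih _).trans ?_
    exact (Nat.mod_modEq _ _).pow _

theorem smoothTest_iff (N e : ℕ) :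
    smoothTest N e = true ↔ N ∣ (Nat.factorial 1000) ^ 2 ^ e := by
  rw [smoothTest, beq_iff_eq, iterSqMod_modEq N e _, Nat.dvd_iff_mod_eq_zero]

theorem le_of_smoothTest {N e r : ℕ} (h : smoothTest N e = true) (hr : r.Prime) (hrN : r ∣ N) :
    r ≤ 1000 :=
  (hr.dvd_factorial).1 (hr.dvd_of_dvd_pow (hrN.trans ((smoothTest_iff N e).1 h)))

theorem smoothTest_of_forall_le {N e : ℕ} (hN : N < 2 ^ 2 ^ e)
    (h : ∀ r : ℕ, r.Prime → r ∣ N → r ≤ 1000) : smoothTest N e = true := by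
  rw [smoothTest_iff]
  rcases eq_or_ne N 0 with rfl | hN0
  · exact absurd (h 1009 (by norm_num) (dvd_zero _)) (by norm_num)
  rw [Nat.dvd_iff_prime_pow_dvd_dvd]
  intro r j hr hrj
  rcases Nat.eq_zero_or_pos j with rfl | hj
  · simp
  have hrA : r ∣ Nat.factorial 1000 :=
    hr.dvd_factorial.2 (h r hr ((dvd_pow_self r hj.ne').trans hrj))
  have hje : j ≤ 2 ^ e := by
    by_contra! hlt
    have h1 : 2 ^ j ≤ r ^ j := Nat.pow_le_pow_left hr.two_le j
    have h2 := Nat.le_of_dvd (Nat.pos_of_ne_zero hN0) hrj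
    have h3 : 2 ^ 2 ^ e ≤ 2 ^ j := Nat.pow_le_pow_right (by norm_num) hlt.le
    omega
  exact (pow_dvd_pow r hje).trans (pow_dvd_pow_of_dvd hrA _)

theorem powSubOneTest_of_forall_le {p n : ℕ} (hp : 0 < p)
    (h : ∀ r : ℕ, r.Prime → r ∣ p ^ n - 1 → r ≤ 1000) : powSubOneTest p n = true := by
  refine smoothTest_of_forall_le ?_ h
  have h1 : p ^ n ≤ 2 ^ ((p.log2 + 1) * n) := by
    rw [pow_mul]
    exact Nat.pow_le_pow_left Nat.lt_log2_self.le n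
  have h2 : 2 ^ ((p.log2 + 1) * n) ≤ 2 ^ 2 ^ (((p.log2 + 1) * n).log2 + 1) :=
    Nat.pow_le_pow_right (by norm_num) Nat.lt_log2_self.le
  have h3 : 0 < p ^ n := pow_pos hp n
  omega

theorem smallFactor_eq_false {n : ℕ} (hn : n.Prime) : smallFactor n = false := by
  rw [smallFactor, List.any_eq_false]
  intro d hd h
  rw [Bool.and_eq_true, beq_iff_eq, Nat.blt_eq] at h
  rcases (Nat.dvd_prime hn).1 (Nat.dvd_of_mod_eq_zero h.1) with rfl | rfl
  · simp at hd
  · exact lt_irrefl _ h.2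

theorem ble_one_eq_false {n : ℕ} (hn : n.Prime) : n.ble 1 = false := by
  rw [Bool.eq_false_iff, ne_eq, Nat.ble_eq]
  exact hn.one_lt.not_ge

/-! ### Large prime exponents -/

theorem lt_of_prime_dvd_sub_one {l n : ℕ} (hl : l.Prime) (hl' : 500 ≤ l) (hn : n.Prime)
    (h : l ∣ n - 1) : 1000 < n := by
  obtain ⟨c, hc⟩ := h
  have hn2 := hn.two_le
  have hlo := hl.eq_two_or_odd
  have hno := hn.eq_two_or_odd
  rcases c with _ | _ | c
  · omega
  · omega
  · have : l * 2 ≤ l * (c + 1 + 1) := Nat.mul_le_mul_left l (by omega)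
    omega

/-- If `p ≤ 1000` and `l ≥ 500` are primes, then `p ^ l - 1` has a prime factor greater than
`1000`: the prime factors of `1 + p + ⋯ + p ^ (l - 1)` are congruent to `1` modulo `l`. -/
theorem exists_prime_dvd_pow_sub_one {p l : ℕ} (hp : p.Prime) (hp' : p ≤ 1000) (hl : l.Prime)
    (hl' : 500 ≤ l) : ∃ r : ℕ, r.Prime ∧ r ∣ p ^ l - 1 ∧ 1000 < r := by
  have hG : ∑ i ∈ Finset.range l, p ^ i ≠ 1 := by
    have : ∑ i ∈ Finset.range 2, p ^ i ≤ ∑ i ∈ Finset.range l, p ^ i :=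
      Finset.sum_le_sum_of_subset (Finset.range_mono hl.two_le)
    simp only [Finset.sum_range_succ, Finset.sum_range_zero, pow_zero, pow_one] at this
    have := hp.two_le
    omega
  obtain ⟨r, hr, hrG⟩ := Nat.exists_prime_and_dvd hG
  have := Fact.mk hr
  have hsum : ∑ i ∈ Finset.range l, (p : ZMod r) ^ i = 0 := by
    have := (ZMod.natCast_eq_zero_iff _ r).2 hrG
    push_cast at this
    exact this
  have hpow : (p : ZMod r) ^ l = 1 := by
    have := geom_sum_mul (p : ZMod r) l
    rw [hsum, zero_mul] at this
    exact (sub_eq_zero.1 this.symm)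
  refine ⟨r, hr, ?_, ?_⟩
  · rw [← ZMod.natCast_eq_zero_iff, Nat.cast_sub (Nat.one_le_pow _ _ hp.pos)]
    simp [hpow]
  · by_cases h1 : (p : ZMod r) = 1
    · have hrl : r ∣ l := by
        rw [← ZMod.natCast_eq_zero_iff, ← hsum]
        simp [h1]
      obtain rfl := (Nat.prime_dvd_prime_iff_eq hr hl).1 hrl
      refine absurd (lt_of_prime_dvd_sub_one hr hl' hp ?_) hp'.not_gt
      rw [← ZMod.natCast_eq_zero_iff, Nat.cast_sub hp.one_le, h1]
      simp
    · have := Fact.mk hl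
      refine lt_of_prime_dvd_sub_one hl hl' hr ?_
      rw [← orderOf_eq_prime hpow h1]
      refine ZMod.orderOf_dvd_card_sub_one fun h0 => ?_
      rw [h0, zero_pow hl.ne_zero] at hpow
      exact zero_ne_one hpow

theorem dvd_of_forall_prime_pow {k M : ℕ}
    (h : ∀ l : ℕ, l.Prime → ∃ e, l ^ e ∣ M ∧ ¬ l ^ (e + 1) ∣ k) : k ∣ M := by
  rw [Nat.dvd_iff_prime_pow_dvd_dvd]
  intro l j hl hj
  obtain ⟨e, he, hek⟩ := h l hl
  have hje : j ≤ e := by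
    by_contra! hlt
    exact hek ((pow_dvd_pow l hlt).trans hj)
  exact (pow_dvd_pow l hje).trans he

/-! ### The order of `PSL(2, F)` -/

theorem card_SL_two (F : Type*) [Field F] [Finite F] :
    Nat.card SL(2, F) = Nat.card F * (Nat.card F ^ 2 - 1) := by
  have := Fintype.ofFinite F
  have hsurj : Function.Surjective (Matrix.GeneralLinearGroup.det : GL (Fin 2) F →* Fˣ) :=
    Matrix.GeneralLinearGroup.det_surjective
  have hker : Nat.card (Matrix.GeneralLinearGroup.det : GL (Fin 2) F →* Fˣ).ker =
      Nat.card SL(2, F) := by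
    refine (Nat.card_congr (Equiv.ofBijective
      (fun g : SL(2, F) => (⟨Matrix.SpecialLinearGroup.toGL g, ?_⟩ :
        (Matrix.GeneralLinearGroup.det : GL (Fin 2) F →* Fˣ).ker)) ⟨?_, ?_⟩)).symm
    · rw [MonoidHom.mem_ker]
      ext
      simp
    · intro a b hab
      exact Matrix.SpecialLinearGroup.toGL_injective (Subtype.ext_iff.1 hab)
    · rintro ⟨g, hg⟩
      rw [MonoidHom.mem_ker] at hg
      refine ⟨⟨(g : Matrix (Fin 2) (Fin 2) F), ?_⟩, ?_⟩
      · simpa using congrArg Units.val hg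
      · ext
        rfl
  have hcard := Subgroup.card_mul_index
    (Matrix.GeneralLinearGroup.det : GL (Fin 2) F →* Fˣ).ker
  rw [hker, Subgroup.index_ker, MonoidHom.range_eq_top.2 hsurj, Subgroup.card_top,
    Matrix.card_GL_field, Nat.card_units, ← Nat.card_eq_fintype_card, Fin.prod_univ_two] at hcard
  have h1 : 1 < Nat.card F := Finite.one_lt_card
  refine Nat.eq_of_mul_eq_mul_right (Nat.sub_pos_of_lt h1) (hcard.trans ?_)
  simp only [Fin.val_zero, Fin.val_one, pow_zero, pow_one]
  rw [pow_two, ← Nat.mul_sub_one]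
  ring

theorem prime_dvd_card_PSL_two_le_iff (F : Type*) [Field F] [Finite F] {B : ℕ} (hB : 2 ≤ B) :
    (∀ r : ℕ, r.Prime → r ∣ Nat.card PSL(2, F) → r ≤ B) ↔
      ∀ r : ℕ, r.Prime → r ∣ Nat.card F * (Nat.card F ^ 2 - 1) → r ≤ B := by
  have hcard := Subgroup.card_eq_card_quotient_mul_card_subgroup
    (Subgroup.center (SL(2, F)))
  rw [card_SL_two] at hcard
  have hcenter : Nat.card (Subgroup.center (SL(2, F))) ≤ 2 := by
    rw [Nat.card_congr (Matrix.SpecialLinearGroup.center_equiv_rootsOfUnity' (0 : Fin 2)).toEquiv]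
    have := card_rootsOfUnity F (Fintype.card (Fin 2))
    simpa using this
  rw [hcard]
  refine ⟨fun h r hr hrd => ?_, fun h r hr hrd => h r hr (hrd.mul_right _)⟩
  rcases hr.dvd_mul.1 hrd with h1 | h1
  · exact h r hr h1
  · exact ((Nat.le_of_dvd Nat.card_pos h1).trans hcenter).trans hB

/-! ### The classification -/

theorem mem_listedOrders_of_forall_le {p k : ℕ} (hp : p.Prime) (hk : 4 ≤ k)
    (h : ∀ r : ℕ, r.Prime → r ∣ p ^ k * ((p ^ k) ^ 2 - 1) → r ≤ 1000) :
    p ^ k ∈ listedOrders := by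
  have hp1000 : p < 1001 :=
    Nat.lt_succ_of_le (h p hp ((dvd_pow_self p (by omega)).mul_right _))
  have hpow {n r : ℕ} (hn : n ∣ 2 * k) (hr : r.Prime) (hrn : r ∣ p ^ n - 1) : r ≤ 1000 := by
    refine h r hr ((hrn.trans ?_).mul_left _)
    rw [← pow_mul, mul_comm k 2]
    exact Nat.pow_sub_one_dvd_pow_sub_one p hn
  have htest {n : ℕ} (hn : n ∣ 2 * k) : powSubOneTest p n = true :=
    powSubOneTest_of_forall_le hp.pos fun r hr hrn => hpow hn hr hrn
  have hdvd : k ∣ (exponentBound p).1 * (exponentBound p).2 := by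
    refine dvd_of_forall_prime_pow fun l hl => ?_
    rcases lt_or_ge l 500 with hl500 | hl500
    · have hb := List.all_eq_true.1 exponentBoundTest_exponentBound p (List.mem_range.2 hp1000)
      rw [ble_one_eq_false hp, smallFactor_eq_false hp, Bool.false_or, Bool.false_or] at hb
      have hb' := List.all_eq_true.1 hb l (List.mem_range.2 hl500)
      rw [ble_one_eq_false hl, smallFactor_eq_false hl, Bool.false_or, Bool.false_or,
        List.any_eq_true] at hb'
      obtain ⟨e, -, he⟩ := hb'
      rw [Bool.and_eq_true, beq_iff_eq, Bool.or_eq_true, Bool.not_eq_true', Bool.not_eq_true'] at he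
      refine ⟨e, Nat.dvd_of_mod_eq_zero he.1, fun hlk => ?_⟩
      have h1 := htest (hlk.mul_left 2)
      have h2 := htest (mul_dvd_mul_left 2 hlk)
      rcases he.2 with h3 | h3 <;> simp_all
    · refine ⟨0, by simp, fun hlk => ?_⟩
      rw [zero_add, pow_one] at hlk
      obtain ⟨r, hr, hrd, hr1000⟩ := exists_prime_dvd_pow_sub_one hp (by omega) hl hl500
      exact hr1000.not_ge (hpow (hlk.mul_left 2) hr hrd)
  obtain ⟨a, b, ha, hb, rfl⟩ := (Nat.dvd_mul).1 hdvd
  have hM : 0 < (exponentBound p).1 ∧ 0 < (exponentBound p).2 := by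
    unfold exponentBound
    split_ifs <;> simp
  have hd := List.all_eq_true.1 divisorTest_exponentBound p (List.mem_range.2 hp1000)
  rw [ble_one_eq_false hp, smallFactor_eq_false hp, Bool.false_or, Bool.false_or] at hd
  have hd1 := List.all_eq_true.1 hd a
    (List.mem_range.2 (Nat.lt_succ_of_le (Nat.le_of_dvd hM.1 ha)))
  rw [Nat.mod_eq_zero_of_dvd ha, beq_self_eq_true, Bool.not_true, Bool.false_or] at hd1
  have hd2 := List.all_eq_true.1 hd1 b
    (List.mem_range.2 (Nat.lt_succ_of_le (Nat.le_of_dvd hM.2 hb)))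
  have h3 : (a * b).ble 3 = false := by
    rw [Bool.eq_false_iff, ne_eq, Nat.ble_eq]
    omega
  rw [Nat.mod_eq_zero_of_dvd hb, beq_self_eq_true, Bool.not_true, Bool.false_or, h3,
    Bool.false_or, htest dvd_rfl, Bool.not_true, Bool.or_false] at hd2
  exact List.contains_iff_mem.1 hd2

/-- Let `q = p^k` with `p` prime and `k ≥ 4`. Then every prime divisor of the order of
`PSL(2, q)` is at most `1000` if and only if `q` belongs to the listed set. -/
theorem PSL_two_high_power_narrow_iff (p k q : ℕ) [hp : Fact p.Prime]
    (hk : 4 ≤ k) (hq : q = p ^ k) :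
    (∀ r : ℕ, r.Prime → r ∣ Nat.card PSL(2, GaloisField p k) → r ≤ 1000) ↔
      q ∈ ({2 ^ 4, 2 ^ 5, 2 ^ 6, 2 ^ 7, 2 ^ 8, 2 ^ 9, 2 ^ 10, 2 ^ 11, 2 ^ 12, 2 ^ 14,
        2 ^ 15, 2 ^ 18, 2 ^ 24, 3 ^ 4, 3 ^ 5, 3 ^ 6, 3 ^ 8, 3 ^ 9, 5 ^ 4, 5 ^ 5, 5 ^ 6,
        7 ^ 6, 19 ^ 6, 29 ^ 6, 43 ^ 4} : Finset ℕ) := by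
  rw [prime_dvd_card_PSL_two_le_iff _ (by norm_num), GaloisField.card p k (by omega), ← hq]
  trans q ∈ listedOrders
  · refine ⟨fun h => ?_, fun h r hr hrd => ?_⟩
    · subst hq
      exact mem_listedOrders_of_forall_le hp.out hk h
    · exact le_of_smoothTest (List.all_eq_true.1 smoothTest_listedOrders q h) hr hrd
  · simp only [listedOrders, List.mem_cons, List.not_mem_nil, or_false, Finset.mem_insert,
      Finset.mem_singleton]
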